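/- Let p be a prime and R := ℤ_p[[T]], the ring of formal power series in one variable over the p-adic integers. Let M be a finitely generated torsion R-module containing no nonzero R-submodule of finite cardinality. Then there exist an integer n > 0 and an injective R-linear map f : R^n → R^n such that M is isomorphic as an R-module to the cokernel of f; equivalently, there is an exact sequence 0 → R^n → R^n → M → 0 of R-modules. -/

import Mathlib

open TensorProduct in
/-- Koszul-style criterion: a second syzygy condition forces freeness. -/
theorem free_of_koszul {R : Type*} [CommRing R] [IsDomain R] [IsLocalRing R] [IsNoetherianRing R]
    (u v : R) (hu : u ∈ IsLocalRing.maximalIdeal R) (hv : v ∈ IsLocalRing.maximalIdeal R)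
    (hm : ∀ r ∈ IsLocalRing.maximalIdeal R, ∃ a b : R, r = a * u + b * v)
    (hvp : Prime v) (hvu : ¬ v ∣ u) (n : ℕ) (K : Submodule R (Fin n → R))
    (hK : ∀ c, u • c ∈ K → v • c ∈ K → c ∈ K) : Module.Free R K := by
  have : Module.FinitePresentation R K := Module.finitePresentation_of_finite R K
  apply Module.free_of_maximalIdeal_rTensor_injective
  let U : IsLocalRing.maximalIdeal R := ⟨u, hu⟩
  let V : IsLocalRing.maximalIdeal R := ⟨v, hv⟩
  have form : ∀ t : (IsLocalRing.maximalIdeal R) ⊗[R] K,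
      ∃ a b : K, t = U ⊗ₜ[R] a + V ⊗ₜ[R] b := by
    intro t
    induction t with
    | zero => exact ⟨0, 0, by simp⟩
    | tmul r k =>
      obtain ⟨a, b, h⟩ := hm r.1 r.2
      have hr : r = a • U + b • V := by
        apply Subtype.ext
        simpa using h
      refine ⟨a • k, b • k, ?_⟩
      rw [hr, TensorProduct.add_tmul, TensorProduct.smul_tmul, TensorProduct.smul_tmul]
    | add s t hs ht =>
      obtain ⟨a, b, rfl⟩ := hs
      obtain ⟨c, d, rfl⟩ := ht
      refine ⟨a + c, b + d, ?_⟩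
      rw [TensorProduct.tmul_add, TensorProduct.tmul_add]
      abel
  rw [injective_iff_map_eq_zero]
  intro t ht
  obtain ⟨a, b, rfl⟩ := form t
  have h0 : u • (a : Fin n → R) + v • (b : Fin n → R) = 0 := by
    have := congrArg (fun z => ((TensorProduct.lid R K z : K) : Fin n → R)) ht
    simpa [U, V] using this
  have hdiv : ∀ i, ∃ c, (a : Fin n → R) i = v * c := by
    intro i
    have hi := congrFun h0 i
    simp only [Pi.add_apply, Pi.smul_apply, smul_eq_mul, Pi.zero_apply] at hi
    have : v ∣ u * (a : Fin n → R) i := ⟨-(b : Fin n → R) i, by linear_combination hi⟩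
    exact (hvp.dvd_or_dvd this).resolve_left hvu
  choose c hc using hdiv
  have ha : (a : Fin n → R) = v • c := funext fun i => by simp [hc]
  have hb : (b : Fin n → R) = -(u • c) := funext fun i => by
    have hi := congrFun h0 i
    simp only [Pi.add_apply, Pi.smul_apply, smul_eq_mul, Pi.zero_apply, hc] at hi
    apply mul_left_cancel₀ hvp.ne_zero
    simp only [Pi.neg_apply, Pi.smul_apply, smul_eq_mul]
    linear_combination hi
  have hcK : c ∈ K := by
    apply hK
    · have := K.neg_mem b.2
      rwa [hb, neg_neg] at this
    · have := a.2
      rwa [ha] at this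
  have ha' : a = v • (⟨c, hcK⟩ : K) := Subtype.ext ha
  have hb' : b = -(u • (⟨c, hcK⟩ : K)) := Subtype.ext hb
  have hUV : v • U = u • V := Subtype.ext (by simp [U, V, mul_comm])
  rw [ha', hb', TensorProduct.tmul_neg, ← TensorProduct.smul_tmul, ← TensorProduct.smul_tmul, hUV,
    add_neg_cancel]

theorem padic_decomp (p : ℕ) [Fact p.Prime] (f : PowerSeries ℤ_[p]) :
    ∃ k : ℕ, k < p ∧ ∃ a b : PowerSeries ℤ_[p],
      f = (k : PowerSeries ℤ_[p]) + a * (p : PowerSeries ℤ_[p]) + b * PowerSeries.X := by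
  have h := PadicInt.sub_zmodRepr_mem (PowerSeries.constantCoeff f)
  rw [PadicInt.maximalIdeal_eq_span_p, Ideal.mem_span_singleton] at h
  obtain ⟨d, hd⟩ := h
  obtain ⟨g, hg⟩ : PowerSeries.X ∣ f - PowerSeries.C (PowerSeries.constantCoeff f) := by
    rw [PowerSeries.X_dvd_iff]; simp
  refine ⟨_, PadicInt.zmodRepr_lt_p (PowerSeries.constantCoeff f), PowerSeries.C d, g, ?_⟩
  have h2 := congrArg (PowerSeries.C (R := ℤ_[p])) hd
  simp only [map_sub, map_mul, map_natCast] at h2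
  linear_combination hg + h2

theorem statement10_aux (p : ℕ) [Fact p.Prime] :
    (p : PowerSeries ℤ_[p]) ∈ IsLocalRing.maximalIdeal (PowerSeries ℤ_[p]) ∧
    (PowerSeries.X : PowerSeries ℤ_[p]) ∈ IsLocalRing.maximalIdeal (PowerSeries ℤ_[p]) := by
  constructor <;> rw [IsLocalRing.mem_maximalIdeal, mem_nonunits_iff,
    PowerSeries.isUnit_iff_constantCoeff]
  · rw [map_natCast]
    exact PadicInt.prime_p.not_isUnit
  · simp

/-- Over `R = ℤ_p[[T]]`, a finitely generated torsion `R`-module `M`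
with no nonzero finite `R`-submodule admits a presentation
`0 → Rⁿ → Rⁿ → M → 0` with `n > 0` and injective first map. -/
theorem statement10 (p : ℕ) [Fact p.Prime]
    (M : Type*) [AddCommGroup M] [Module (PowerSeries ℤ_[p]) M]
    [Module.Finite (PowerSeries ℤ_[p]) M]
    (htors : ∀ x : M, ∃ r : PowerSeries ℤ_[p], r ≠ 0 ∧ r • x = 0)
    (hnofin : ∀ N : Submodule (PowerSeries ℤ_[p]) M, (N : Set M).Finite → N = ⊥) :
    ∃ n : ℕ, 0 < n ∧
      ∃ f : (Fin n → PowerSeries ℤ_[p]) →ₗ[PowerSeries ℤ_[p]] (Fin n → PowerSeries ℤ_[p]),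
        Function.Injective f ∧
        Nonempty (M ≃ₗ[PowerSeries ℤ_[p]]
          ((Fin n → PowerSeries ℤ_[p]) ⧸ LinearMap.range f)) := by
  obtain ⟨hp, hX⟩ := statement10_aux p
  have hdec := padic_decomp p
  -- elements killed by the maximal ideal vanish
  have hsoc : ∀ c : M, (p : PowerSeries ℤ_[p]) • c = 0 →
      (PowerSeries.X : PowerSeries ℤ_[p]) • c = 0 → c = 0 := by
    intro c h1 h2
    rw [← Submodule.span_singleton_eq_bot (R := PowerSeries ℤ_[p])]
    apply hnofin
    apply ((Set.finite_Iio p).image (fun k : ℕ => (k : PowerSeries ℤ_[p]) • c)).subset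
    intro z hz
    obtain ⟨f, rfl⟩ := Submodule.mem_span_singleton.mp hz
    obtain ⟨k, hk, a, b, rfl⟩ := hdec f
    exact ⟨k, hk, by simp [add_smul, mul_smul, h1, h2]⟩
  obtain ⟨n, hn, g, hg⟩ : ∃ n : ℕ, 0 < n ∧
      ∃ g : (Fin n → PowerSeries ℤ_[p]) →ₗ[PowerSeries ℤ_[p]] M, Function.Surjective g := by
    obtain ⟨n, g, hg⟩ := Module.Finite.exists_fin' (PowerSeries ℤ_[p]) M
    refine ⟨n + 1, n.succ_pos,
      g ∘ₗ LinearMap.funLeft (PowerSeries ℤ_[p]) (PowerSeries ℤ_[p]) Fin.castSucc, ?_⟩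
    exact hg.comp (LinearMap.funLeft_surjective_of_injective _ _ _ (Fin.castSucc_injective n))
  have hfree : Module.Free (PowerSeries ℤ_[p]) (LinearMap.ker g) := by
    refine free_of_koszul (p : PowerSeries ℤ_[p]) PowerSeries.X hp hX ?_ PowerSeries.X_prime ?_ n _
      ?_
    · intro r hr
      obtain ⟨k, hk, a, b, h⟩ := hdec r
      have hkm : (k : PowerSeries ℤ_[p]) ∈ IsLocalRing.maximalIdeal (PowerSeries ℤ_[p]) := by
        have : (k : PowerSeries ℤ_[p]) = r - a * (p : PowerSeries ℤ_[p]) - b * PowerSeries.X := by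
          linear_combination -h
        rw [this]
        exact sub_mem (sub_mem hr (Ideal.mul_mem_left _ _ hp)) (Ideal.mul_mem_left _ _ hX)
      have hk0 : k = 0 := by
        by_contra hk0
        rw [IsLocalRing.mem_maximalIdeal, mem_nonunits_iff,
          PowerSeries.isUnit_iff_constantCoeff, map_natCast] at hkm
        apply hkm
        rw [PadicInt.isUnit_iff, PadicInt.norm_natCast_eq_one_iff]
        exact Nat.coprime_of_lt_prime hk0 hk Fact.out
      exact ⟨a, b, by simpa [hk0] using h⟩
    · rw [PowerSeries.X_dvd_iff, map_natCast]
      exact PadicInt.prime_p.ne_zero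
    · intro c h1 h2
      simp only [LinearMap.mem_ker, map_smul] at h1 h2 ⊢
      exact hsoc _ h1 h2
  have hM : Module.finrank (PowerSeries ℤ_[p]) M = 0 := by
    rw [Module.finrank_eq_zero_iff]
    exact htors
  have hrank : Module.finrank (PowerSeries ℤ_[p]) (LinearMap.ker g) = n := by
    have h := Submodule.finrank_quotient_add_finrank (LinearMap.ker g)
    rw [(g.quotKerEquivOfSurjective hg).finrank_eq, hM] at h
    simpa using h
  let e := (Module.finBasisOfFinrankEq (PowerSeries ℤ_[p]) (LinearMap.ker g) hrank).equivFun
  refine ⟨n, hn, (LinearMap.ker g).subtype ∘ₗ e.symm.toLinearMap, ?_, ⟨?_⟩⟩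
  · exact Subtype.val_injective.comp e.symm.injective
  · refine (g.quotKerEquivOfSurjective hg).symm ≪≫ₗ Submodule.quotEquivOfEq _ _ ?_
    rw [LinearMap.range_comp, LinearEquiv.range, Submodule.map_top, Submodule.range_subtype]
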